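/- For every plane rooted tree T, the plucking polynomial Q(T) is a product of Gaussian binomial coefficients: there exist finitely many pairs of nonnegative integers (a_1, c_1), …, (a_r, c_r) such that Q(T) = Π_{j=1}^{r} (a_j + c_j choose a_j)_q in ℤ[q]. -/

import Mathlib

/-- A plane rooted tree: a root with an ordered list of plane rooted subtrees. -/
inductive PTree : Type where
  | node : List PTree → PTree

namespace PTree

mutual
/-- Number of edges of a plane rooted tree. -/
def edges : PTree → ℕ
  | .node l => edgesL l
def edgesL : List PTree → ℕ
  | [] => 0
  | t :: ts => (edges t + 1) + edgesL ts
end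

mutual
/-- Number of vertices of a plane rooted tree. -/
def vertices : PTree → ℕ
  | .node l => 1 + verticesL l
def verticesL : List PTree → ℕ
  | [] => 0
  | t :: ts => vertices t + verticesL ts
end

mutual
/-- `plucks T` is the list, indexed by the leaves `v` of `T`, of the pairs
`(r(T,v), T - v)`, where `r(T,v)` is the number of vertices strictly to the
right of the path from `v` to the root, and `T - v` is `T` with the leaf `v`
(and its edge) deleted. -/
def plucks : PTree → List (ℕ × PTree)
  | .node l => (plucksL l).map (fun p => (p.1, PTree.node p.2))
def plucksL : List PTree → List (ℕ × List PTree)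
  | [] => []
  | t :: ts =>
      (match t with
       | .node [] => [(verticesL ts, ts)]
       | .node (s :: ss) =>
          (plucks (.node (s :: ss))).map (fun p => (p.1 + verticesL ts, p.2 :: ts)))
      ++ (plucksL ts).map (fun p => (p.1, t :: p.2))
end

/-- The plucking polynomial, computed with a fuel parameter (the fuel is the
number of edges; each plucking removes exactly one edge). -/
noncomputable def Qfuel : ℕ → PTree → Polynomial ℤ
  | 0, _ => 1
  | (k+1), t =>
      if edges t = 0 then 1
      else ((plucks t).map (fun p => Polynomial.X ^ p.1 * Qfuel k p.2)).sum

/-- The plucking polynomial `Q(T)` of a plane rooted tree: `Q(T) = 1` if `T` has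
no edges, and otherwise `Q(T) = Σ_v q^{r(T,v)} Q(T - v)`, summed over the leaves of `T`. -/
noncomputable def Q (t : PTree) : Polynomial ℤ := Qfuel (edges t) t

end PTree

/-- The `q`-analogue `[a]_q = 1 + q + ⋯ + q^{a-1}`. -/
noncomputable def qInt (a : ℕ) : Polynomial ℤ := (Finset.range a).sum (fun i => Polynomial.X ^ i)

/-- The `q`-factorial `[a]_q! = [1]_q [2]_q ⋯ [a]_q`. -/
noncomputable def qFact : ℕ → Polynomial ℤ
  | 0 => 1
  | (a+1) => qFact a * qInt (a+1)

/-- The `q`-multinomial coefficient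
`(a₁+⋯+a_k choose a₁,…,a_k)_q = [a₁+⋯+a_k]_q! / ([a₁]_q! ⋯ [a_k]_q!)`
(the division, by a monic polynomial, is exact). -/
noncomputable def qMultinomial (l : List ℕ) : Polynomial ℤ :=
  qFact l.sum /ₘ (l.map qFact).prod

/-- The Gaussian binomial coefficient `(a+c choose a)_q`. -/
noncomputable def qBinom (a c : ℕ) : Polynomial ℤ := qMultinomial [a, c]

lemma qInt_add (a c : ℕ) : qInt (a + c) = Polynomial.X ^ c * qInt a + qInt c := by
  rw [qInt, add_comm a c, Finset.sum_range_add, qInt, qInt, Finset.mul_sum, add_comm]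
  simp only [pow_add]

lemma qInt_succ_monic (a : ℕ) : (qInt (a + 1)).Monic :=
  Polynomial.Monic.geom_sum' Polynomial.monic_X (by simp) (Nat.succ_ne_zero a)

lemma qFact_monic : ∀ a : ℕ, (qFact a).Monic
  | 0 => Polynomial.monic_one
  | a + 1 => (qFact_monic a).mul (qInt_succ_monic a)

/-- The Gaussian binomial coefficients, defined by the `q`-Pascal recursion. -/
noncomputable def gauss : ℕ → ℕ → Polynomial ℤ
  | 0, _ => 1
  | _ + 1, 0 => 1
  | a + 1, c + 1 => Polynomial.X ^ (c + 1) * gauss a (c + 1) + gauss (a + 1) c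

lemma gauss_zero_right (a : ℕ) : gauss a 0 = 1 := by
  cases a <;> simp [gauss]

lemma gauss_mul_qFact (a c : ℕ) : qFact a * qFact c * gauss a c = qFact (a + c) := by
  induction a, c using gauss.induct with
  | case1 c => simp [gauss, qFact]
  | case2 a => simp [gauss, qFact]
  | case3 a c iha ihc =>
    have h : qInt (a + 1 + (c + 1)) = _ := qInt_add (a + 1) (c + 1)
    have e : a + 1 + c = a + (c + 1) := by omega
    rw [e] at ihc
    change qFact (a + 1) * qFact (c + 1) * _ = qFact (a + 1 + c) * qInt (a + 1 + (c + 1))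
    rw [gauss, e, h]
    simp only [qFact] at iha ihc ⊢
    linear_combination (Polynomial.X ^ (c + 1) * qInt (a + 1)) * iha + qInt (c + 1) * ihc

lemma qBinom_eq_gauss (a c : ℕ) : qBinom a c = gauss a c := by
  have hm : (qFact a * qFact c).Monic := (qFact_monic a).mul (qFact_monic c)
  simp only [qBinom, qMultinomial, List.sum_cons, List.sum_nil, List.map_cons, List.map_nil,
    List.prod_cons, List.prod_nil, add_zero, mul_one]
  rw [← gauss_mul_qFact, Polynomial.mul_divByMonic_cancel_left _ hm]

namespace PTree

mutual
theorem vertices_eq : ∀ t : PTree, vertices t = edges t + 1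
  | .node l => by rw [vertices, edges, verticesL_eq l, add_comm]
theorem verticesL_eq : ∀ l : List PTree, verticesL l = edgesL l
  | [] => by rw [verticesL, edgesL]
  | t :: ts => by rw [verticesL, edgesL, vertices_eq t, verticesL_eq ts]
end

mutual
theorem edges_of_mem_plucks : ∀ (t : PTree), ∀ p ∈ plucks t, edges p.2 + 1 = edges t
  | .node l => by
    intro p hp
    rw [plucks, List.mem_map] at hp
    obtain ⟨p, hp, rfl⟩ := hp
    simpa only [edges] using edgesL_of_mem_plucksL l p hp
theorem edgesL_of_mem_plucksL : ∀ (l : List PTree), ∀ p ∈ plucksL l, edgesL p.2 + 1 = edgesL l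
  | [] => by simp [plucksL]
  | .node [] :: ts => by
    intro p hp
    have ih := edgesL_of_mem_plucksL ts
    simp only [plucksL, List.mem_append, List.mem_singleton, List.mem_map] at hp
    rcases hp with rfl | ⟨p, hp, rfl⟩
    · simp only [edgesL, edges]; omega
    · simp only [edgesL, ← ih p hp]; omega
  | .node (s :: ss) :: ts => by
    intro p hp
    have ih := edgesL_of_mem_plucksL ts
    have iht := edges_of_mem_plucks (.node (s :: ss))
    rw [plucksL] at hp
    simp only [List.mem_append, List.mem_map] at hp
    rcases hp with ⟨p, hp, rfl⟩ | ⟨p, hp, rfl⟩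
    · rw [edgesL, edgesL, ← iht p hp]; omega
    · rw [edgesL, edgesL, ← ih p hp]; omega
end

mutual
/-- The product over the vertices of `t` of the `q`-multinomial coefficients of the numbers of
vertices of the subtrees at their children, each written as a product of Gaussian binomials. -/
noncomputable def gaussProd : PTree → Polynomial ℤ
  | .node l => gaussProdL l
noncomputable def gaussProdL : List PTree → Polynomial ℤ
  | [] => 1
  | t :: ts => gauss (edges t + 1) (edgesL ts) * gaussProd t * gaussProdL ts
end

/-- The weighted sum over the leaves of a forest that defines the plucking recursion. -/
noncomputable def pluckSumL (l : List PTree) : Polynomial ℤ :=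
  ((plucksL l).map (fun p => Polynomial.X ^ p.1 * gaussProdL p.2)).sum

lemma pluckSumL_nil : pluckSumL [] = 0 := by simp [pluckSumL, plucksL]

lemma sum_plucks_node (l : List PTree) :
    ((plucks (.node l)).map (fun p => Polynomial.X ^ p.1 * gaussProd p.2)).sum = pluckSumL l := by
  simp [plucks, pluckSumL, gaussProd, Function.comp_def]

lemma sum_plucksL_cons (t : PTree) (ts : List PTree) :
    ((plucksL ts).map (fun p => Polynomial.X ^ p.1 * gaussProdL (t :: p.2))).sum =
      gauss (edges t + 1) (edgesL ts - 1) * gaussProd t * pluckSumL ts := by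
  rw [pluckSumL, ← List.sum_map_mul_left]
  congr 1
  refine List.map_congr_left fun p hp => ?_
  rw [gaussProdL, ← edgesL_of_mem_plucksL ts p hp, Nat.add_sub_cancel]
  ring

lemma sum_plucks_head (t : PTree) (ts : List PTree) :
    ((plucks t).map
      (fun p => Polynomial.X ^ (p.1 + edgesL ts) * gaussProdL (p.2 :: ts))).sum =
      Polynomial.X ^ edgesL ts * gauss (edges t) (edgesL ts) * gaussProdL ts *
        ((plucks t).map (fun p => Polynomial.X ^ p.1 * gaussProd p.2)).sum := by
  rw [← List.sum_map_mul_left]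
  congr 1
  refine List.map_congr_left fun p hp => ?_
  rw [gaussProdL, edges_of_mem_plucks t p hp]
  ring

lemma gauss_pascal_forest (t : PTree) (ts : List PTree)
    (h : ts ≠ [] → pluckSumL ts = gaussProdL ts) :
    Polynomial.X ^ edgesL ts * gauss (edges t) (edgesL ts) * gaussProdL ts * gaussProd t +
      gauss (edges t + 1) (edgesL ts - 1) * gaussProd t * pluckSumL ts = gaussProdL (t :: ts) := by
  cases ts with
  | nil => simp [pluckSumL_nil, gaussProdL, edgesL, gauss_zero_right]
  | cons s ss =>
    rw [h (by simp), gaussProdL.eq_2 t]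
    obtain ⟨n, hn⟩ : ∃ n, edgesL (s :: ss) = n + 1 := ⟨edges s + edgesL ss, by rw [edgesL]; omega⟩
    rw [hn, gauss, Nat.add_sub_cancel]
    ring

theorem pluckSumL_eq : ∀ l : List PTree, l ≠ [] → pluckSumL l = gaussProdL l
  | [] => fun h => absurd rfl h
  | .node [] :: ts => fun _ => by
    rw [← gauss_pascal_forest _ _ (pluckSumL_eq ts), ← sum_plucksL_cons, pluckSumL, plucksL]
    simp [gaussProd, gaussProdL, edges, edgesL, verticesL_eq, gauss, Function.comp_def]
  | .node (s :: ss) :: ts => fun _ => by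
    have ih := pluckSumL_eq (s :: ss) (by simp)
    rw [← gauss_pascal_forest _ _ (pluckSumL_eq ts), ← sum_plucksL_cons, gaussProd, ← ih,
      ← sum_plucks_node (s :: ss), ← sum_plucks_head, pluckSumL, plucksL]
    simp only [List.map_append, List.sum_append, List.map_map, Function.comp_def, verticesL_eq]

theorem Qfuel_eq_gaussProd (k : ℕ) : ∀ t : PTree, edges t = k → Qfuel k t = gaussProd t := by
  induction k with
  | zero =>
    rintro ⟨_ | ⟨s, ss⟩⟩ h
    · simp [Qfuel, gaussProd, gaussProdL]
    · rw [edges, edgesL] at h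
      omega
  | succ k ih =>
    rintro ⟨l⟩ h
    have hl : l ≠ [] := by
      rintro rfl
      simp [edges, edgesL] at h
    rw [Qfuel, if_neg (by omega), gaussProd, ← pluckSumL_eq l hl, ← sum_plucks_node]
    congr 1
    refine List.map_congr_left fun p hp => ?_
    rw [ih p.2 (by have := edges_of_mem_plucks _ p hp; omega)]

mutual
theorem exists_gaussProd_eq : ∀ t : PTree,
    ∃ ps : List (ℕ × ℕ), gaussProd t = (ps.map (fun p => qBinom p.1 p.2)).prod
  | .node l => by
    rw [gaussProd]
    exact exists_gaussProdL_eq l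
theorem exists_gaussProdL_eq : ∀ l : List PTree,
    ∃ ps : List (ℕ × ℕ), gaussProdL l = (ps.map (fun p => qBinom p.1 p.2)).prod
  | [] => ⟨[], by simp [gaussProdL]⟩
  | t :: ts => by
    obtain ⟨ps, hps⟩ := exists_gaussProd_eq t
    obtain ⟨qs, hqs⟩ := exists_gaussProdL_eq ts
    refine ⟨(edges t + 1, edgesL ts) :: (ps ++ qs), ?_⟩
    rw [gaussProdL, hps, hqs, ← qBinom_eq_gauss]
    simp [mul_assoc]
end

end PTree

/-- For every plane rooted tree `T`, the plucking polynomial `Q(T)` is a product of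
Gaussian binomial coefficients: there are finitely many pairs of nonnegative integers
`(a₁, c₁), …, (a_r, c_r)` with `Q(T) = Π_{j=1}^{r} (aⱼ + cⱼ choose aⱼ)_q` in `ℤ[q]`. -/
theorem plucking_product_of_gaussians (t : PTree) :
    ∃ ps : List (ℕ × ℕ), PTree.Q t = (ps.map (fun p => qBinom p.1 p.2)).prod := by
  rw [PTree.Q, PTree.Qfuel_eq_gaussProd _ t rfl]
  exact PTree.exists_gaussProd_eq t
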